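/- arXiv:1907.08762 — 3 statements merged into one kernel-verified Lean document; each statement's English description precedes it below -/
import Mathlib

section
/- Ps-normality is additive: if X_α is a Ps-normal topological space for every α ∈ Λ, then the topological sum ⊕_{α∈Λ} X_α is Ps-normal. -/
open Set Topology Filter

universe u v

/-- A subset `K` of a topological space is pseudocompact if every continuous
real-valued function on `K` (with the subspace topology) is bounded. -/
def IsPseudocompactSet {X : Type u} [TopologicalSpace X] (K : Set X) : Prop :=
  ∀ f : K → ℝ, Continuous f → ∃ M : ℝ, ∀ x : K, |f x| ≤ M

/-- A subset `K` is countably compact if every countable open cover of `K`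
has a finite subcover. -/
def IsCountablyCompactSet {X : Type u} [TopologicalSpace X] (K : Set X) : Prop :=
  ∀ U : ℕ → Set X, (∀ n, IsOpen (U n)) → K ⊆ ⋃ n, U n →
    ∃ t : Finset ℕ, K ⊆ ⋃ n ∈ t, U n

/-- `f` restricts to a homeomorphism of `K` onto `f '' K`
(both with their subspace topologies). -/
def RestrictsToHomeo {X : Type u} {Y : Type v} [TopologicalSpace X] [TopologicalSpace Y]
    (f : X → Y) (K : Set X) : Prop :=
  ∃ e : K ≃ₜ (f '' K), ∀ x : K, (e x : Y) = f x

/-- `X` is Ps-normal. -/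
def PsNormal (X : Type u) [TopologicalSpace X] : Prop :=
  ∃ (Y : Type u) (_ : TopologicalSpace Y) (f : X → Y), NormalSpace Y ∧
    Function.Bijective f ∧ ∀ K : Set X, IsPseudocompactSet K → RestrictsToHomeo f K

/-- `X` is CC-normal. -/
def CCNormal (X : Type u) [TopologicalSpace X] : Prop :=
  ∃ (Y : Type u) (_ : TopologicalSpace Y) (f : X → Y), NormalSpace Y ∧
    Function.Bijective f ∧ ∀ K : Set X, IsCountablyCompactSet K → RestrictsToHomeo f K

/-- `X` is C-normal. -/
def CNormal (X : Type u) [TopologicalSpace X] : Prop :=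
  ∃ (Y : Type u) (_ : TopologicalSpace Y) (f : X → Y), NormalSpace Y ∧
    Function.Bijective f ∧ ∀ K : Set X, IsCompact K → RestrictsToHomeo f K

/-- `X` is Ps-Tychonoff. -/
def PsTychonoff (X : Type u) [TopologicalSpace X] : Prop :=
  ∃ (Y : Type u) (_ : TopologicalSpace Y) (f : X → Y), T35Space Y ∧
    Function.Bijective f ∧ ∀ K : Set X, IsPseudocompactSet K → RestrictsToHomeo f K

/-- `X` is C-Tychonoff. -/
def CTychonoff (X : Type u) [TopologicalSpace X] : Prop :=
  ∃ (Y : Type u) (_ : TopologicalSpace Y) (f : X → Y), T35Space Y ∧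
    Function.Bijective f ∧ ∀ K : Set X, IsCompact K → RestrictsToHomeo f K

/-- `X` is L-Tychonoff. -/
def LTychonoff (X : Type u) [TopologicalSpace X] : Prop :=
  ∃ (Y : Type u) (_ : TopologicalSpace Y) (f : X → Y), T35Space Y ∧
    Function.Bijective f ∧ ∀ K : Set X, IsLindelof K → RestrictsToHomeo f K

theorem restrictsToHomeo_iff_isEmbedding {X : Type u} {Y : Type v} [TopologicalSpace X]
    [TopologicalSpace Y] {f : X → Y} {K : Set X} :
    RestrictsToHomeo f K ↔ IsEmbedding (K.domRestrict f) := by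
  constructor
  · rintro ⟨e, he⟩
    have h : K.domRestrict f = Subtype.val ∘ e := funext fun x => (he x).symm
    rw [h]
    exact IsEmbedding.subtypeVal.comp e.isEmbedding
  · intro h
    exact ⟨h.toHomeomorph.trans (Homeomorph.setCongr (range_domRestrict f K)), fun _ => rfl⟩

theorem Topology.IsOpenEmbedding.continuous_extend_zero {X : Type u} {Y : Type v}
    [TopologicalSpace X] [TopologicalSpace Y] {i : X → Y} (hi : IsOpenEmbedding i)
    (hc : IsClosed (range i)) {g : X → ℝ} (hg : Continuous g) :
    Continuous (Function.extend i g 0) := by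
  refine continuous_iff_continuousAt.2 fun y => ?_
  by_cases hy : y ∈ range i
  · obtain ⟨x, rfl⟩ := hy
    rw [← hi.continuousAt_iff, Function.extend_comp hi.injective]
    exact hg.continuousAt
  · have h : Function.extend i g (0 : Y → ℝ) =ᶠ[𝓝 y] fun _ => 0 := by
      filter_upwards [hc.isOpen_compl.mem_nhds hy] with z hz
      exact Function.extend_apply' g (0 : Y → ℝ) z hz
    exact continuousAt_const.congr h.symm

theorem IsPseudocompactSet.preimage_of_isOpenEmbedding_of_isClosedEmbedding {X : Type u}
    {Y : Type v} [TopologicalSpace X] [TopologicalSpace Y] {i : X → Y} {K : Set Y}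
    (hK : IsPseudocompactSet K) (ho : IsOpenEmbedding i) (hc : IsClosedEmbedding i) :
    IsPseudocompactSet (i ⁻¹' K) := by
  intro g hg
  have hoK := ho.restrictPreimage K
  obtain ⟨M, hM⟩ := hK _
    (hoK.continuous_extend_zero (hc.restrictPreimage K).isClosed_range hg)
  refine ⟨M, fun x => ?_⟩
  simpa [hoK.injective.extend_apply] using hM (K.restrictPreimage i x)

theorem NormalSpace.sigma {ι : Type u} {Y : ι → Type v} [∀ i, TopologicalSpace (Y i)]
    [∀ i, NormalSpace (Y i)] : NormalSpace (Σ i, Y i) where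
  normal s t hs ht hst := by
    have h (i : ι) : SeparatedNhds (Sigma.mk i ⁻¹' s) (Sigma.mk i ⁻¹' t) :=
      normal_separation (isClosed_sigma_iff.1 hs i) (isClosed_sigma_iff.1 ht i)
        (hst.preimage _)
    choose U V hU hV hsU htV hUV using h
    exact ⟨{x | x.2 ∈ U x.1}, {x | x.2 ∈ V x.1}, isOpen_sigma_iff.2 hU, isOpen_sigma_iff.2 hV,
      fun x hx => hsU x.1 hx, fun x hx => htV x.1 hx,
      Set.disjoint_left.2 fun x hxU hxV => Set.disjoint_left.1 (hUV x.1) hxU hxV⟩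

theorem isOpen_iff_restrictPreimage_sigmaMk {ι : Type u} {X : ι → Type v}
    [∀ i, TopologicalSpace (X i)] {K : Set (Σ i, X i)} {s : Set K} :
    IsOpen s ↔ ∀ i, IsOpen (K.restrictPreimage (Sigma.mk i) ⁻¹' s) := by
  refine ⟨fun hs i => hs.preimage (IsOpenEmbedding.sigmaMk.restrictPreimage K).continuous,
    fun h => ?_⟩
  have hs : s = ⋃ i, K.restrictPreimage (Sigma.mk i) ''
      (K.restrictPreimage (Sigma.mk i) ⁻¹' s) := by
    ext x
    simp only [mem_iUnion]
    constructor
    · intro hx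
      exact ⟨x.1.1, ⟨x.1.2, x.2⟩, hx, rfl⟩
    · rintro ⟨i, y, hy, rfl⟩
      exact hy
  rw [hs]
  exact isOpen_iUnion fun i =>
    (IsOpenEmbedding.sigmaMk.restrictPreimage K).isOpenMap _ (h i)

theorem isEmbedding_restrict_sigmaMap {ι : Type u} {X Y : ι → Type v}
    [∀ i, TopologicalSpace (X i)] [∀ i, TopologicalSpace (Y i)] {f : ∀ i, X i → Y i}
    {K : Set (Σ i, X i)} (h : ∀ i, IsEmbedding ((Sigma.mk i ⁻¹' K).domRestrict (f i))) :
    IsEmbedding (K.domRestrict (Sigma.map id f)) := by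
  refine ⟨⟨TopologicalSpace.ext (funext fun s => propext ?_)⟩, ?_⟩
  · rw [isOpen_iff_restrictPreimage_sigmaMk, isOpen_induced_iff]
    constructor
    · intro hs
      choose t ht hts using fun i => (h i).isInducing.isOpen_iff.1 (hs i)
      refine ⟨{y | y.2 ∈ t y.1}, isOpen_sigma_iff.2 ht, ?_⟩
      ext ⟨⟨i, x⟩, hx⟩
      exact Set.ext_iff.1 (hts i) ⟨x, hx⟩
    · rintro ⟨t, ht, rfl⟩ i
      exact (isOpen_sigma_iff.1 ht i).preimage (h i).continuous
  · rintro ⟨⟨i, x⟩, hx⟩ ⟨⟨j, y⟩, hy⟩ hxy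
    obtain rfl : i = j := congrArg Sigma.fst hxy
    have := (h i).injective (a₁ := ⟨x, hx⟩) (a₂ := ⟨y, hy⟩) (sigma_mk_injective hxy)
    cases this
    rfl

/-- Ps-normality is additive: a topological sum of Ps-normal spaces is Ps-normal. -/
theorem psNormal_sigma {Λ : Type u} {Xa : Λ → Type u} [∀ α, TopologicalSpace (Xa α)]
    (h : ∀ α : Λ, PsNormal (Xa α)) : PsNormal (Σ α, Xa α) := by
  choose Y tY f hY hf hK using h
  refine ⟨Σ α, Y α, inferInstance, Sigma.map id f, NormalSpace.sigma,
    ⟨Function.injective_id.sigma_map fun α => (hf α).1,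
      Function.surjective_id.sigma_map fun α => (hf α).2⟩, fun K hPs => ?_⟩
  refine restrictsToHomeo_iff_isEmbedding.2 (isEmbedding_restrict_sigmaMap fun α => ?_)
  exact restrictsToHomeo_iff_isEmbedding.1 (hK α _
    (hPs.preimage_of_isOpenEmbedding_of_isClosedEmbedding .sigmaMk .sigmaMk))
end

section
/- Let X be a Fréchet topological space, let Y be a normal topological space, and let f : X → Y be a bijection such that for every pseudocompact subset K of X the restriction f|_K : K → f(K) is a homeomorphism (i.e., f is a witness of Ps-normality of X). Then f is continuous. -/
open Set Topology Filter

universe u v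

/-- A compact set is pseudocompact. -/
theorem IsCompact.isPseudocompactSet {X : Type u} [TopologicalSpace X] {K : Set X}
    (hK : IsCompact K) : IsPseudocompactSet K := by
  intro g hg
  have : CompactSpace K := isCompact_iff_compactSpace.mp hK
  obtain ⟨M, hM⟩ := (isCompact_range hg).exists_bound_of_continuousOn continuousOn_id
  exact ⟨M, fun x => by simpa using hM (g x) (mem_range_self x)⟩

/-- A map restricting to a homeomorphism of `K` onto its image is continuous on `K`. -/
theorem RestrictsToHomeo.continuousOn {X : Type u} {Y : Type v} [TopologicalSpace X]
    [TopologicalSpace Y] {f : X → Y} {K : Set X} (h : RestrictsToHomeo f K) :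
    ContinuousOn f K := by
  obtain ⟨e, he⟩ := h
  rw [continuousOn_iff_continuous_domRestrict]
  exact (continuous_subtype_val.comp e.continuous).congr he

/-- A witness of Ps-normality of a Fréchet space is continuous. -/
theorem continuous_of_psNormal_witness {X : Type u} {Y : Type v}
    [TopologicalSpace X] [TopologicalSpace Y] [FrechetUrysohnSpace X] [NormalSpace Y]
    (f : X → Y) (hf : Function.Bijective f)
    (hw : ∀ K : Set X, IsPseudocompactSet K → RestrictsToHomeo f K) :
    Continuous f := by
  refine SeqContinuous.continuous fun u x hu => ?_
  have hK := (hw _ hu.isCompact_insert_range.isPseudocompactSet).continuousOn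
  exact (hK x (mem_insert x _)).tendsto.comp <| tendsto_nhdsWithin_iff.mpr
    ⟨hu, Eventually.of_forall fun n => mem_insert_of_mem x (mem_range_self n)⟩
end

section
/- Every C-Tychonoff Fréchet topological space is Urysohn (T2.5): any two distinct points have neighborhoods with disjoint closures. -/
open Set Topology Filter

universe u v

/-- In a sequential space, continuity can be checked on compact subsets. -/
theorem continuous_of_continuousOn_isCompact {X : Type u} {Y : Type v} [TopologicalSpace X]
    [SequentialSpace X] [TopologicalSpace Y] {f : X → Y}
    (hf : ∀ K : Set X, IsCompact K → ContinuousOn f K) : Continuous f := by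
  refine continuous_iff_seqContinuous.2 fun s x hs => ?_
  have hx := hf _ hs.isCompact_insert_range x (mem_insert _ _)
  exact hx.tendsto.comp (tendsto_nhdsWithin_iff.2
    ⟨hs, Eventually.of_forall fun n => mem_insert_of_mem _ (mem_range_self n)⟩)

/-- Every C-Tychonoff Fréchet topological space is Urysohn (T₂.₅): any two distinct
points have neighborhoods with disjoint closures. -/
theorem cTychonoff_frechet_urysohn {X : Type u} [TopologicalSpace X]
    [FrechetUrysohnSpace X] (hX : CTychonoff X) :
    ∀ x y : X, x ≠ y → ∃ U ∈ 𝓝 x, ∃ V ∈ 𝓝 y,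
      Disjoint (closure U) (closure V) := by
  obtain ⟨Y, _, f, _, hf, hK⟩ := hX
  have hc : Continuous f :=
    continuous_of_continuousOn_isCompact fun K h => (hK K h).continuousOn
  have : T25Space X := T25Space.of_injective_continuous hf.injective hc
  exact fun x y hxy => exists_nhds_disjoint_closure hxy
end
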